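/- Let k be a field of characteristic p > 0, let q = p^ν be a power of p (ν ≥ 0), and let m be an integer with 1 ≤ m ≤ q. Then there is an isomorphism of k[X]-modules M_m ⊗_k M_q ≅ (M_q)^m, where X acts on the tensor product as X⊗1 + 1⊗X. (Equivalently, the Jordan normal form of T_{m,q} consists of exactly m Jordan blocks, all of size q.) -/

import Mathlib

open Polynomial TensorProduct

/-- `M_n := k[X]/(X^n)`, with the convention `M_0 = 0`. -/
abbrev Mq (k : Type) [Field k] (n : ℕ) : Type :=
  Polynomial k ⧸ Ideal.span {(Polynomial.X : Polynomial k) ^ n}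

/-- Multiplication by `X` on `M_n`, as a `k`-linear endomorphism. -/
noncomputable def mulX (k : Type) [Field k] (n : ℕ) : Module.End k (Mq k n) :=
  (LinearMap.lsmul (Polynomial k) (Mq k n) (Polynomial.X : Polynomial k)).restrictScalars k

/-- The endomorphism `X ⊗ 1 + 1 ⊗ X` of `M_m ⊗_k M_n`. -/
noncomputable def tensorX (k : Type) [Field k] (m n : ℕ) :
    Module.End k (TensorProduct k (Mq k m) (Mq k n)) :=
  TensorProduct.map (mulX k m) LinearMap.id + TensorProduct.map LinearMap.id (mulX k n)

theorem mulX_pow_apply (k : Type) [Field k] (n j : ℕ) (y : Mq k n) :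
    (mulX k n ^ j) y = (X : k[X]) ^ j • y := by
  induction j generalizing y with
  | zero => simp
  | succ j ih =>
    rw [pow_succ, Module.End.mul_apply, ih, pow_succ, mul_smul]
    rfl

theorem mulX_mk (k : Type) [Field k] (n : ℕ) (f : k[X]) :
    mulX k n (Submodule.Quotient.mk f) = Submodule.Quotient.mk (X * f) :=
  rfl

theorem mulX_pow_eq_zero (k : Type) [Field k] {n N : ℕ} (h : n ≤ N) : mulX k n ^ N = 0 := by
  refine LinearMap.ext fun x => ?_
  rw [mulX_pow_apply]
  induction x using Submodule.Quotient.induction_on with | _ f =>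
  rw [← Submodule.Quotient.mk_smul, LinearMap.zero_apply, Submodule.Quotient.mk_eq_zero,
    Ideal.mem_span_singleton]
  exact (pow_dvd_pow X h).mul_right f

theorem tensorX_pow_prime_pow_eq_zero (k : Type) [Field k] (p : ℕ) [CharP k p] (hp : p.Prime)
    (ν : ℕ) {m n : ℕ} (hm : m ≤ p ^ ν) (hn : n ≤ p ^ ν) : tensorX k m n ^ p ^ ν = 0 := by
  have hc : Commute (TensorProduct.map (mulX k m) (LinearMap.id : Module.End k (Mq k n)))
      (TensorProduct.map (LinearMap.id : Module.End k (Mq k m)) (mulX k n)) :=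
    TensorProduct.ext' fun _ _ => rfl
  obtain ⟨r, hr⟩ := hc.exists_add_pow_prime_pow_eq hp ν
  have hp0 : (p : Module.End k (Mq k m ⊗[k] Mq k n)) = 0 := by
    rw [← map_natCast (algebraMap k _), CharP.cast_eq_zero, map_zero]
  rw [tensorX, hr, hp0, TensorProduct.map_pow, TensorProduct.map_pow, mulX_pow_eq_zero k hm,
    mulX_pow_eq_zero k hn, TensorProduct.map_zero_left, TensorProduct.map_zero_right]
  simp only [zero_mul, add_zero]

theorem tensorX_mk_X_pow_tmul (k : Type) [Field k] (m n i j : ℕ) :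
    tensorX k m n
        ((Submodule.Quotient.mk (X ^ i) : Mq k m) ⊗ₜ[k] (Submodule.Quotient.mk (X ^ j) : Mq k n)) =
      (Submodule.Quotient.mk (X ^ (i + 1)) : Mq k m) ⊗ₜ[k]
          (Submodule.Quotient.mk (X ^ j) : Mq k n) +
        (Submodule.Quotient.mk (X ^ i) : Mq k m) ⊗ₜ[k]
          (Submodule.Quotient.mk (X ^ (j + 1)) : Mq k n) := by
  rw [tensorX, LinearMap.add_apply, TensorProduct.map_tmul, TensorProduct.map_tmul, mulX_mk,
    mulX_mk, ← pow_succ', ← pow_succ']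
  rfl

/-- A subspace of `M_n` containing the powers of `X` is everything. -/
theorem mem_of_forall_mk_X_pow_mem (k : Type) [Field k] (n : ℕ) (S : Submodule k (Mq k n))
    (h : ∀ i, (Submodule.Quotient.mk (X ^ i) : Mq k n) ∈ S) (a : Mq k n) : a ∈ S := by
  induction a using Submodule.Quotient.induction_on with | _ f =>
  induction f using Polynomial.induction_on' with
  | add f g hf hg => exact S.add_mem hf hg
  | monomial i c =>
    rw [← Polynomial.smul_X_eq_monomial]
    exact S.smul_mem c (h i)

theorem mem_of_forall_mk_X_pow_tmul_mem (k : Type) [Field k] (m n : ℕ)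
    (S : Submodule k (Mq k m ⊗[k] Mq k n))
    (h : ∀ i j, (Submodule.Quotient.mk (X ^ i) : Mq k m) ⊗ₜ[k]
      (Submodule.Quotient.mk (X ^ j) : Mq k n) ∈ S) (t : Mq k m ⊗[k] Mq k n) : t ∈ S := by
  induction t using TensorProduct.induction_on with
  | zero => exact S.zero_mem
  | add x y hx hy => exact S.add_mem hx hy
  | tmul a b =>
    refine mem_of_forall_mk_X_pow_mem k m
      (S.comap ((TensorProduct.mk k (Mq k m) (Mq k n)).flip b)) (fun i => ?_) a
    exact mem_of_forall_mk_X_pow_mem k n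
      (S.comap (TensorProduct.mk k (Mq k m) (Mq k n) (Submodule.Quotient.mk (X ^ i))))
      (fun j => h i j) b

theorem finite_Mq (k : Type) [Field k] (n : ℕ) : Module.Finite k (Mq k n) :=
  (monic_X_pow n).finite_quotient

theorem finrank_Mq (k : Type) [Field k] (n : ℕ) : Module.finrank k (Mq k n) = n := by
  rw [finrank_quotient_span_eq_natDegree, natDegree_X_pow]

/-- An element `x` killed by `X ^ n` determines the `k[X]`-linear map `M_n → N`, `1 ↦ x`. -/
noncomputable def Mq.lift (k : Type) [Field k] {N : Type} [AddCommGroup N] [Module k[X] N] (n : ℕ)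
    (x : N) (hx : (X : k[X]) ^ n • x = 0) : Mq k n →ₗ[k[X]] N :=
  Submodule.liftQ _ (LinearMap.toSpanSingleton k[X] N x) <| by
    rw [Ideal.span, Submodule.span_singleton_le_iff_mem]
    exact hx

theorem Mq.lift_mk_one (k : Type) [Field k] {N : Type} [AddCommGroup N] [Module k[X] N] (n : ℕ)
    (x : N) (hx : (X : k[X]) ^ n • x = 0) :
    Mq.lift k n x hx (Submodule.Quotient.mk 1) = x :=
  one_smul k[X] x

/-- If `φ ^ n = 0` and the `φ`-invariant subspace generated by `e₁, …, e_m` is all of `V`, with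
`dim V = m * n`, then `V` is a free `k[X]/(X^n)`-module of rank `m`. -/
theorem nonempty_aeval'_equiv_of_pow_eq_zero (k : Type) [Field k] {V : Type} [AddCommGroup V]
    [Module k V] [FiniteDimensional k V] (φ : Module.End k V) {m n : ℕ} (hφ : φ ^ n = 0)
    (e : Fin m → V)
    (he : ∀ S : Submodule k V, (∀ x ∈ S, φ x ∈ S) → (∀ i, e i ∈ S) → S = ⊤)
    (hrank : Module.finrank k V = m * n) :
    Nonempty (Module.AEval' φ ≃ₗ[k[X]] (Fin m → Mq k n)) := by
  have hX (i : Fin m) : (X : k[X]) ^ n • Module.AEval'.of φ (e i) = 0 := by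
    rw [Module.AEval'.X_pow_smul_of, hφ, zero_smul, map_zero]
  let L : (Fin m → Mq k n) →ₗ[k[X]] Module.AEval' φ :=
    LinearMap.lsum k[X] (fun _ : Fin m => Mq k n) k[X] fun i =>
      Mq.lift k n (Module.AEval'.of φ (e i)) (hX i)
  have hsurj : Function.Surjective L := by
    have h := he ((L.range.restrictScalars k).comap (Module.AEval'.of φ).toLinearMap) ?_ ?_
    · intro y
      obtain ⟨v, rfl⟩ := (Module.AEval'.of φ).surjective y
      exact (h ▸ Submodule.mem_top :
        v ∈ (L.range.restrictScalars k).comap (Module.AEval'.of φ).toLinearMap)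
    · intro x hx
      have h := L.range.smul_mem X (show Module.AEval'.of φ x ∈ L.range from hx)
      rwa [Module.AEval'.X_smul_of] at h
    · intro i
      refine ⟨LinearMap.single k[X] (fun _ : Fin m => Mq k n) i (Submodule.Quotient.mk 1), ?_⟩
      rw [LinearMap.coe_single, LinearMap.lsum_piSingle]
      exact Mq.lift_mk_one k n _ (hX i)
  have := finite_Mq k n
  have : Module.Finite k (Module.AEval' φ) := Module.Finite.equiv (Module.AEval'.of φ)
  have hrank' : Module.finrank k (Fin m → Mq k n) = Module.finrank k (Module.AEval' φ) := by
    rw [← (Module.AEval'.of φ).finrank_eq, hrank, Module.finrank_pi_fintype, finrank_Mq,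
      Finset.sum_const, Finset.card_univ, Fintype.card_fin, smul_eq_mul]
  have hinj : Function.Injective (L.restrictScalars k) :=
    (LinearMap.injective_iff_surjective_of_finrank_eq_finrank hrank').2 hsurj
  exact ⟨(LinearEquiv.ofBijective L ⟨hinj, hsurj⟩).symm⟩

/-- A `tensorX`-invariant subspace of `M_m ⊗ M_n` containing all `X^i ⊗ 1` with `i < m` is
everything. -/
theorem eq_top_of_mk_X_pow_tmul_one_mem (k : Type) [Field k] (m n : ℕ)
    (S : Submodule k (Mq k m ⊗[k] Mq k n)) (hS : ∀ x ∈ S, tensorX k m n x ∈ S)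
    (h : ∀ i < m, (Submodule.Quotient.mk (X ^ i) : Mq k m) ⊗ₜ[k]
      (Submodule.Quotient.mk 1 : Mq k n) ∈ S) : S = ⊤ := by
  have key : ∀ j i, (Submodule.Quotient.mk (X ^ i) : Mq k m) ⊗ₜ[k]
        (Submodule.Quotient.mk (X ^ j) : Mq k n) ∈ S := by
    intro j
    induction j with
    | zero =>
      intro i
      rw [pow_zero]
      rcases lt_or_ge i m with hi | hi
      · exact h i hi
      · have h0 : (Submodule.Quotient.mk (X ^ i) : Mq k m) = 0 := by
          rw [Submodule.Quotient.mk_eq_zero, Ideal.mem_span_singleton]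
          exact pow_dvd_pow X hi
        rw [h0, TensorProduct.zero_tmul]
        exact S.zero_mem
    | succ j ih =>
      intro i
      have h1 := hS _ (ih i)
      rw [tensorX_mk_X_pow_tmul] at h1
      exact (Submodule.add_mem_iff_right S (ih (i + 1))).1 h1
  exact eq_top_iff.2 fun t _ => mem_of_forall_mk_X_pow_tmul_mem k m n S (fun i j => key j i) t

/-- Let `k` be a field of characteristic `p > 0`, `q = p^ν`, and `1 ≤ m ≤ q`.  Then
`M_m ⊗_k M_q ≅ (M_q)^m` as `k[X]`-modules, where `X` acts on the tensor product as
`X⊗1 + 1⊗X`; i.e. the Jordan form of `T_{m,q}` consists of exactly `m` blocks of size `q`. -/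
theorem tensor_prime_power_decomposition (k : Type) [Field k] (p : ℕ) [CharP k p]
    (hp : 0 < p) (ν : ℕ) (q : ℕ) (hq : q = p ^ ν) (m : ℕ) (hm : 1 ≤ m) (hmq : m ≤ q) :
    Nonempty ((Module.AEval' (tensorX k m q)) ≃ₗ[Polynomial k]
      (Fin m → Mq k q)) := by
  have hprime : p.Prime := (CharP.char_is_prime_or_zero k p).resolve_right hp.ne'
  subst hq
  have := finite_Mq k m
  have := finite_Mq k (p ^ ν)
  refine nonempty_aeval'_equiv_of_pow_eq_zero k (tensorX k m (p ^ ν))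
    (tensorX_pow_prime_pow_eq_zero k p hprime ν hmq le_rfl)
    (fun i => (Submodule.Quotient.mk (X ^ (i : ℕ)) : Mq k m) ⊗ₜ[k]
      (Submodule.Quotient.mk 1 : Mq k (p ^ ν)))
    (fun S hS h => eq_top_of_mk_X_pow_tmul_one_mem k m (p ^ ν) S hS fun i hi => h ⟨i, hi⟩) ?_
  rw [Module.finrank_tensorProduct, finrank_Mq, finrank_Mq]
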